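/- arXiv:2207.08358 — 2 statements merged into one kernel-verified Lean document; each statement's English description precedes it below -/
import Mathlib

section
/- Let d ≥ 2. There exists a constant C_d > 0 such that for every L ≥ 1 and every δ with L^{-1} ≤ δ ≤ 1, the number of lattice pairs #{(a,b) ∈ (L^{-1}ℤ^d) × (L^{-1}ℤ^d) : |a| ≤ 1, |b| ≤ 1, |⟨a,b⟩| ≤ δ} is at most C_d · L^{2d} · δ. -/
lemma card_fib {α β : Type*} [DecidableEq β] (s : Finset α) (t : Finset β) (f : α → β) (r : ℝ)
    (hf : ∀ a ∈ s, f a ∈ t)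
    (hr : ∀ b ∈ t, ((s.filter (fun a => f a = b)).card : ℝ) ≤ r) : (s.card : ℝ) ≤ t.card * r := by
  rw [Finset.card_eq_sum_card_fiberwise (f := f) (t := t) hf]
  push_cast
  calc _ ≤ ∑ b ∈ t, r := Finset.sum_le_sum hr
    _ = _ := by simp

lemma card_Icc_le (m : ℤ) (x : ℝ) (hm : (m : ℝ) ≤ x) (hx : 1 ≤ x) :
    ((Finset.Icc (-m) m).card : ℝ) ≤ 3 * x := by
  rw [Int.card_Icc]
  have h : (((m + 1 - -m).toNat : ℤ) : ℝ) = max ((m:ℝ) + 1 + m) 0 := by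
    rw [Int.toNat_eq_max]; push_cast; ring_nf
  rw [← Int.cast_natCast, h]
  apply max_le <;> linarith

lemma card_pi_le {k : ℕ} (i : Fin (k+2)) (t m : ℤ) (x : ℝ) (hm : (m : ℝ) ≤ x) (hx : 1 ≤ x) :
    ((Fintype.piFinset (fun j : Fin (k+2) => if j = i then {t} else Finset.Icc (-m) m)).card : ℝ)
      ≤ (3 * x) ^ (k+1) := by
  rw [Fintype.card_piFinset, ← Finset.mul_prod_erase Finset.univ _ (Finset.mem_univ i)]
  simp only [if_true, Finset.card_singleton, one_mul]
  push_cast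
  calc _ ≤ ∏ j ∈ Finset.univ.erase i, (3 * x) := by
        apply Finset.prod_le_prod
        · intros; positivity
        · intro j hj
          rw [if_neg (Finset.ne_of_mem_erase hj)]
          exact card_Icc_le m x hm hx
    _ = _ := by simp

lemma card_interval (s : Finset ℤ) (t : ℤ) (ht : t ≠ 0) (c M : ℝ) (hM : |(t : ℝ)| ≤ M)
    (hs : ∀ x ∈ s, |(t : ℝ) * x + c| ≤ M) : (s.card : ℝ) ≤ 3 * M / |(t : ℝ)| := by
  have ht' : (t : ℝ) ≠ 0 := by exact_mod_cast ht
  have hp : 0 < |(t : ℝ)| := abs_pos.mpr ht'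
  have h1 : 1 ≤ M / |(t : ℝ)| := by rw [le_div_iff₀ hp]; linarith
  have hsub : s ⊆ Finset.Icc ⌈-c/t - M / |(t:ℝ)|⌉ ⌊-c/t + M / |(t:ℝ)|⌋ := by
    intro x hx
    have h := hs x hx
    have e : (t : ℝ) * x + c = t * (x - (-c/t)) := by field_simp; ring
    rw [e, abs_mul, mul_comm, ← le_div_iff₀ hp, abs_le] at h
    rw [Finset.mem_Icc, Int.ceil_le, Int.le_floor]
    constructor <;> linarith
  have h2 : (s.card : ℝ) ≤ _ := Nat.cast_le.mpr (Finset.card_le_card hsub)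
  refine h2.trans ?_
  rw [Int.card_Icc, ← Int.cast_natCast, Int.toNat_eq_max, mul_div_assoc]
  push_cast
  have := Int.floor_le (-c/t + M / |(t:ℝ)|)
  have := Int.le_ceil (-c/t - M / |(t:ℝ)|)
  apply max_le <;> linarith

lemma card_b {k : ℕ} (i : Fin (k+2)) (a : Fin (k+2) → ℤ) (N : ℤ) (L M : ℝ) (hN : (N:ℝ) ≤ L)
    (hL : 1 ≤ L) (ha : a i ≠ 0) (hM : |(a i : ℝ)| ≤ M) (s : Finset (Fin (k+2) → ℤ))
    (hs : ∀ b ∈ s, (∀ j, b j ∈ Finset.Icc (-N) N) ∧ |∑ j, (a j : ℝ) * b j| ≤ M) :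
    (s.card : ℝ) ≤ (3 * L) ^ (k+1) * (3 * M / |(a i : ℝ)|) := by
  classical
  have hM0 : 0 ≤ M := (abs_nonneg _).trans hM
  refine (card_fib s _ (fun b => Function.update b i 0) (3 * M / |(a i : ℝ)|) ?_ ?_).trans
    (mul_le_mul_of_nonneg_right (card_pi_le i 0 N L hN hL) (by positivity))
  · intro b hb
    rw [Fintype.mem_piFinset]
    intro j
    by_cases h : j = i
    · subst h; simp
    · simpa [h] using (hs b hb).1 j
  · intro e he
    have hinj : Set.InjOn (fun b : Fin (k+2) → ℤ => b i)
        (s.filter (fun b => Function.update b i 0 = e)) := by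
      intro b hb b' hb' h
      simp only [Finset.coe_filter, Set.mem_ofPred_eq] at hb hb'
      have h3 := hb.2.trans hb'.2.symm
      funext j
      by_cases hj : j = i
      · subst hj; exact h
      · simpa [hj] using congrFun h3 j
    rw [← Finset.card_image_of_injOn hinj]
    apply card_interval _ (a i) ha (∑ j ∈ Finset.univ.erase i, (a j : ℝ) * e j) M hM
    intro x hx
    simp only [Finset.mem_image, Finset.mem_filter] at hx
    obtain ⟨b, ⟨hb, hbe⟩, rfl⟩ := hx
    have := (hs b hb).2
    rw [← Finset.add_sum_erase Finset.univ _ (Finset.mem_univ i)] at this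
    convert this using 3
    apply Finset.sum_congr rfl
    intro j hj
    rw [← hbe, Function.update_of_ne (Finset.ne_of_mem_erase hj)]

lemma card_Si {k : ℕ} (i : Fin (k+2)) (N : ℤ) (L M : ℝ) (hN : (N:ℝ) ≤ L)
    (hL : 1 ≤ L) (hM : L ≤ M) (s : Finset ((Fin (k+2) → ℤ) × (Fin (k+2) → ℤ)))
    (hs : ∀ p ∈ s, (∀ j, p.1 j ∈ Finset.Icc (-N) N) ∧ (∀ j, p.2 j ∈ Finset.Icc (-N) N) ∧
      |∑ j, (p.1 j : ℝ) * p.2 j| ≤ M ∧ p.1 i ≠ 0 ∧ ∀ j, |p.1 j| ≤ |p.1 i|) :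
    (s.card : ℝ) ≤ 9 ^ (k+2) * L ^ (2*k+2) * M := by
  classical
  have hM0 : 0 ≤ M := by linarith
  have key : (s.card : ℝ) ≤ (Finset.Icc (-N) N).card *
      (3 ^ (2*k+3) * (L ^ (2*k+1) * M)) := by
    apply card_fib s _ (fun p => p.1 i) _ (fun p hp => (hs p hp).1 i)
    intro t htN
    by_cases ht : t = 0
    · rw [Finset.filter_eq_empty_iff.mpr]
      · simp; positivity
      · intro p hp h
        exact (hs p hp).2.2.2.1 (h.trans ht)
    have ht1 : (1:ℝ) ≤ |(t:ℝ)| := by exact_mod_cast Int.one_le_abs ht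
    have htL : |(t:ℝ)| ≤ L := by
      have : |t| ≤ N := abs_le.mpr (Finset.mem_Icc.mp htN)
      have : |(t:ℝ)| ≤ N := by exact_mod_cast this
      linarith
    have h1 := card_fib (s.filter (fun p => p.1 i = t)) 
      (Fintype.piFinset (fun j : Fin (k+2) => if j = i then {t} else Finset.Icc (-|t|) |t|))
      Prod.fst ((3 * L) ^ (k+1) * (3 * M / |(t : ℝ)|)) ?_ ?_
    · refine h1.trans ((mul_le_mul_of_nonneg_right
        (card_pi_le i t |t| |(t:ℝ)| (by simp) ht1) (by positivity)).trans ?_)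
      have : (3 * |(t:ℝ)|) ^ (k+1) * ((3 * L) ^ (k+1) * (3 * M / |(t : ℝ)|))
          = 3 ^ (2*k+3) * (|(t:ℝ)| ^ k * L ^ (k+1) * M) := by
        have : |(t:ℝ)| ≠ 0 := by positivity
        field_simp
        ring
      rw [this]
      have h2 : |(t:ℝ)| ^ k ≤ L ^ k := pow_le_pow_left₀ (by positivity) htL k
      calc _ ≤ (3:ℝ) ^ (2*k+3) * (L ^ k * L ^ (k+1) * M) := by gcongr
        _ = _ := by ring
    · intro p hp
      rw [Finset.mem_filter] at hp
      obtain ⟨hp, rfl⟩ := hp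
      rw [Fintype.mem_piFinset]
      intro j
      by_cases h : j = i
      · subst h; simp
      · simpa [h] using abs_le.mp ((hs p hp).2.2.2.2 j)
    · intro a _
      have hinj : Set.InjOn (Prod.snd : (Fin (k+2) → ℤ) × (Fin (k+2) → ℤ) → _)
          ((s.filter (fun p => p.1 i = t)).filter (fun p => p.1 = a)) := by
        intro p hp q hq h
        simp only [Finset.coe_filter, Set.mem_ofPred_eq] at hp hq
        exact Prod.ext (hp.2.trans hq.2.symm) h
      by_cases hat : a i = t
      · subst hat
        rw [← Finset.card_image_of_injOn hinj]
        apply card_b i a N L M hN hL ht (htL.trans hM)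
        intro b hb
        simp only [Finset.mem_image, Finset.mem_filter] at hb
        obtain ⟨p, ⟨⟨hp, _⟩, rfl⟩, rfl⟩ := hb
        exact ⟨(hs p hp).2.1, (hs p hp).2.2.1⟩
      · rw [Finset.filter_eq_empty_iff.mpr]
        · simp; positivity
        · intro p hp h
          rw [Finset.mem_filter] at hp
          exact hat (h ▸ hp.2)
  refine key.trans ((mul_le_mul_of_nonneg_right (card_Icc_le N L hN hL) (by positivity)).trans ?_)
  apply le_of_eq
  rw [show (9:ℝ) ^ (k+2) = 3 ^ (2*k+4) by
    rw [show (9:ℝ) = 3^2 by norm_num, ← pow_mul]; ring_nf]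
  ring

lemma card_T {k : ℕ} (N : ℤ) (L M : ℝ) (hN : (N:ℝ) ≤ L)
    (hL : 1 ≤ L) (hM : L ≤ M) (s : Finset ((Fin (k+2) → ℤ) × (Fin (k+2) → ℤ)))
    (hs : ∀ p ∈ s, (∀ j, p.1 j ∈ Finset.Icc (-N) N) ∧ (∀ j, p.2 j ∈ Finset.Icc (-N) N) ∧
      |∑ j, (p.1 j : ℝ) * p.2 j| ≤ M) :
    (s.card : ℝ) ≤ (k+3) * 9 ^ (k+2) * L ^ (2*k+2) * M := by
  classical
  have hM0 : 0 ≤ M := by linarith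
  have hsub : s ⊆ s.filter (fun p => p.1 = 0) ∪ Finset.univ.biUnion (fun i : Fin (k+2) =>
      s.filter (fun p => p.1 i ≠ 0 ∧ ∀ j, |p.1 j| ≤ |p.1 i|)) := by
    intro p hp
    obtain ⟨i, -, hi⟩ := Finset.exists_max_image Finset.univ (fun j => |p.1 j|)
      (Finset.univ_nonempty (α := Fin (k+2)))
    simp only [Finset.mem_union, Finset.mem_filter, Finset.mem_biUnion, Finset.mem_univ, true_and]
    by_cases h : p.1 i = 0
    · left
      refine ⟨hp, funext fun j => ?_⟩
      have := hi j (Finset.mem_univ j)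
      simpa [h] using this
    · right
      exact ⟨i, hp, h, fun j => hi j (Finset.mem_univ j)⟩
  have h0 : ((s.filter (fun p => p.1 = 0)).card : ℝ) ≤ 9 ^ (k+2) * L ^ (2*k+2) * M := by
    have hinj : Set.InjOn (Prod.snd : (Fin (k+2) → ℤ) × (Fin (k+2) → ℤ) → _)
        (s.filter (fun p => p.1 = 0)) := by
      intro p hp q hq h
      simp only [Finset.coe_filter, Set.mem_ofPred_eq] at hp hq
      exact Prod.ext (hp.2.trans hq.2.symm) h
    rw [← Finset.card_image_of_injOn hinj]
    have hs2 : (s.filter (fun p => p.1 = 0)).image Prod.snd ⊆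
        Fintype.piFinset (fun _ : Fin (k+2) => Finset.Icc (-N) N) := by
      intro b hb
      simp only [Finset.mem_image, Finset.mem_filter] at hb
      obtain ⟨p, ⟨hp, _⟩, rfl⟩ := hb
      rw [Fintype.mem_piFinset]
      exact (hs p hp).2.1
    calc _ ≤ ((Fintype.piFinset (fun _ : Fin (k+2) => Finset.Icc (-N) N)).card : ℝ) := by
          exact_mod_cast Finset.card_le_card hs2
      _ = ((Finset.Icc (-N) N).card : ℝ) ^ (k+2) := by
          rw [Fintype.card_piFinset]; simp
      _ ≤ (3 * L) ^ (k+2) := by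
          gcongr; exact card_Icc_le N L hN hL
      _ = 3 ^ (k+2) * L ^ (k+1) * L := by ring
      _ ≤ 9 ^ (k+2) * L ^ (2*k+2) * M := by
          gcongr
          · norm_num
          · omega
          · norm_num
  have h1 : (s.card : ℝ) ≤ _ := Nat.cast_le.mpr (Finset.card_le_card hsub)
  have h2 : ((Finset.univ.biUnion (fun i : Fin (k+2) =>
      s.filter (fun p => p.1 i ≠ 0 ∧ ∀ j, |p.1 j| ≤ |p.1 i|))).card : ℝ) ≤
      ∑ i : Fin (k+2), 9 ^ (k+2) * L ^ (2*k+2) * M := by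
    refine (Nat.cast_le.mpr Finset.card_biUnion_le).trans ?_
    push_cast
    apply Finset.sum_le_sum
    intro i _
    apply card_Si i N L M hN hL hM
    intro p hp
    rw [Finset.mem_filter] at hp
    obtain ⟨a, b, c⟩ := hs p hp.1
    exact ⟨a, b, c, hp.2⟩
  have h3 : (((s.filter (fun p => p.1 = 0)) ∪ Finset.univ.biUnion (fun i : Fin (k+2) =>
      s.filter (fun p => p.1 i ≠ 0 ∧ ∀ j, |p.1 j| ≤ |p.1 i|))).card : ℝ) ≤ _ :=
    Nat.cast_le.mpr (Finset.card_union_le _ _)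
  rw [Finset.sum_const, Finset.card_univ, Fintype.card_fin, nsmul_eq_mul] at h2
  push_cast at h2 h3
  linarith

lemma mem_box {d : ℕ} (a : Fin d → ℤ) (L : ℝ) (hL : 1 ≤ L)
    (h : Real.sqrt (∑ j, ((a j : ℝ) / L) ^ 2) ≤ 1) (j : Fin d) :
    a j ∈ Finset.Icc (-⌊L⌋) ⌊L⌋ := by
  have hL0 : 0 < L := by linarith
  rw [Real.sqrt_le_iff, one_pow] at h
  replace h := h.2
  have h1 : ((a j : ℝ) / L) ^ 2 ≤ 1 :=
    (Finset.single_le_sum (f := fun j => ((a j : ℝ) / L) ^ 2) (fun _ _ => sq_nonneg _)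
      (Finset.mem_univ j)).trans h
  rw [sq_le_one_iff_abs_le_one, abs_div, abs_of_pos hL0, div_le_one hL0] at h1
  rw [Finset.mem_Icc, ← abs_le, Int.le_floor]
  exact_mod_cast h1

/-- **Quasi-resonant lattice point count in the equidistribution regime `δ ≥ L⁻¹`.**
For `d ≥ 2` there is `C_d > 0` such that for all `L ≥ 1` and `L⁻¹ ≤ δ ≤ 1`, the number of
pairs `(a,b) ∈ (L⁻¹ℤ^d)²` with `|a| ≤ 1`, `|b| ≤ 1`, `|⟨a,b⟩| ≤ δ` is at most
`C_d · L^{2d} · δ`. -/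
theorem quasi_resonant_lattice_count (d : ℕ) (hd : 2 ≤ d) :
    ∃ C : ℝ, 0 < C ∧ ∀ L δ : ℝ, 1 ≤ L → L⁻¹ ≤ δ → δ ≤ 1 →
      {p : (Fin d → ℤ) × (Fin d → ℤ) |
        Real.sqrt (∑ j, ((p.1 j : ℝ) / L) ^ 2) ≤ 1 ∧
        Real.sqrt (∑ j, ((p.2 j : ℝ) / L) ^ 2) ≤ 1 ∧
        |∑ j, ((p.1 j : ℝ) / L) * ((p.2 j : ℝ) / L)| ≤ δ}.Finite ∧
      (Nat.card {p : (Fin d → ℤ) × (Fin d → ℤ) |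
        Real.sqrt (∑ j, ((p.1 j : ℝ) / L) ^ 2) ≤ 1 ∧
        Real.sqrt (∑ j, ((p.2 j : ℝ) / L) ^ 2) ≤ 1 ∧
        |∑ j, ((p.1 j : ℝ) / L) * ((p.2 j : ℝ) / L)| ≤ δ} : ℝ) ≤ C * L ^ (2 * d) * δ := by
  obtain ⟨k, rfl⟩ : ∃ k, d = k + 2 := ⟨d - 2, by omega⟩
  refine ⟨(k+3) * 9 ^ (k+2), by positivity, ?_⟩
  intro L δ hL hδ hδ1
  have hL0 : 0 < L := by linarith
  have hfin : {p : (Fin (k+2) → ℤ) × (Fin (k+2) → ℤ) |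
        Real.sqrt (∑ j, ((p.1 j : ℝ) / L) ^ 2) ≤ 1 ∧
        Real.sqrt (∑ j, ((p.2 j : ℝ) / L) ^ 2) ≤ 1 ∧
        |∑ j, ((p.1 j : ℝ) / L) * ((p.2 j : ℝ) / L)| ≤ δ}.Finite := by
    apply Set.Finite.subset (Finset.finite_toSet
      ((Fintype.piFinset (fun _ : Fin (k+2) => Finset.Icc (-⌊L⌋) ⌊L⌋)) ×ˢ
       (Fintype.piFinset (fun _ : Fin (k+2) => Finset.Icc (-⌊L⌋) ⌊L⌋))))
    intro p hp
    rw [Finset.mem_coe, Finset.mem_product, Fintype.mem_piFinset, Fintype.mem_piFinset]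
    exact ⟨mem_box _ L hL hp.1, mem_box _ L hL hp.2.1⟩
  refine ⟨hfin, ?_⟩
  rw [Nat.card_coe_set_eq, Set.ncard_eq_toFinset_card _ hfin]
  refine (card_T ⌊L⌋ L (δ * L ^ 2) (Int.floor_le L) hL ?_ _ ?_).trans (le_of_eq (by ring))
  · rw [inv_le_iff_one_le_mul₀ hL0] at hδ
    nlinarith
  · intro p hp
    rw [Set.Finite.mem_toFinset] at hp
    obtain ⟨h1, h2, h3⟩ := hp
    refine ⟨mem_box _ L hL h1, mem_box _ L hL h2, ?_⟩
    have e : ∑ j, ((p.1 j : ℝ) / L) * ((p.2 j : ℝ) / L) = (∑ j, (p.1 j : ℝ) * p.2 j) / L ^ 2 := by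
      rw [Finset.sum_div]
      apply Finset.sum_congr rfl
      intro j _
      field_simp
    rw [e, abs_div, abs_of_pos (by positivity : 0 < L ^ 2), div_le_iff₀ (by positivity)] at h3
    exact h3
end

section
/- Let d ≥ 3. There exists a constant C_d > 0 such that for every N ≥ 2, the number of pairs of nonzero integer vectors #{(a,b) ∈ (ℤ^d∖{0}) × (ℤ^d∖{0}) : |a| ≤ N, |b| ≤ N, ⟨a,b⟩ = 0} is at most C_d · N^{2d−2}. -/
open Finset in
lemma aux_T (k A : ℕ) [NeZero A] :
    #{p : (Fin (k+1) → ZMod A) × (Fin (k+1) → ZMod A) | ∑ j, p.1 j * p.2 j = 0}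
      ≤ A ^ (k+1) * ∑ m ∈ A.divisors, m ^ k := by
  have hA : A ≠ 0 := NeZero.ne A
  have key : ∀ u : Fin (k+1) → ZMod A, #{x : Fin (k+1) → ZMod A | ∑ j, u j * x j = 0} ≤
      ∑ m ∈ A.divisors, if (∀ j, m • u j = 0) then A ^ (k+1) / m else 0 := by
    intro u
    let f : (Fin (k+1) → ZMod A) →+ ZMod A :=
      { toFun := fun x => ∑ j, u j * x j
        map_zero' := by simp
        map_add' := by intro x y; simp [mul_add, Finset.sum_add_distrib] }
    have h1 := AddSubgroup.card_mul_index f.ker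
    rw [AddSubgroup.index_ker] at h1
    have h2 : Nat.card f.ker = #{x : Fin (k+1) → ZMod A | ∑ j, u j * x j = 0} := by
      rw [Nat.card_eq_fintype_card, Fintype.card_subtype]
      congr 1
      ext x
      simp [f, AddMonoidHom.mem_ker]
    have h3 : Nat.card f.range ∣ A := by
      simpa using AddSubgroup.card_addSubgroup_dvd_card f.range
    have h4 : ∀ j, Nat.card f.range • u j = 0 := by
      intro j
      have : u j ∈ f.range := ⟨Pi.single j 1, by simp [f, Pi.single_apply]⟩
      have h := @card_nsmul_eq_zero' f.range _ ⟨u j, this⟩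
      simpa using congrArg Subtype.val h
    have hpos : 0 < Nat.card f.range := Nat.card_pos
    have h5 : Nat.card (Fin (k+1) → ZMod A) = A ^ (k+1) := by simp
    refine le_trans ?_ (Finset.single_le_sum (f := fun m => if (∀ j, m • u j = 0) then A ^ (k+1) / m else 0) (fun _ _ => Nat.zero_le _)
      (Nat.mem_divisors.2 ⟨h3, hA⟩))
    simp only [h4, implies_true, if_true]
    rw [Nat.le_div_iff_mul_le hpos, ← h2, h1, h5]
  have e1 : #{p : (Fin (k+1) → ZMod A) × (Fin (k+1) → ZMod A) | ∑ j, p.1 j * p.2 j = 0}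
      = ∑ u : Fin (k+1) → ZMod A, #{x : Fin (k+1) → ZMod A | ∑ j, u j * x j = 0} := by
    simp only [Finset.card_filter]
    rw [Fintype.sum_prod_type]
  rw [e1]
  refine (Finset.sum_le_sum fun u _ => key u).trans ?_
  rw [Finset.sum_comm, Finset.mul_sum]
  refine Finset.sum_le_sum fun m hm => ?_
  have hm0 : 0 < m := Nat.pos_of_mem_divisors hm
  rw [← Finset.sum_filter, Finset.sum_const, smul_eq_mul]
  have h6 : #{u : Fin (k+1) → ZMod A | ∀ j, m • u j = 0} ≤ m ^ (k+1) := by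
    have : ({u : Fin (k+1) → ZMod A | ∀ j, m • u j = 0} : Finset _) =
      Fintype.piFinset (fun _ => {y : ZMod A | m • y = 0}) := by
      ext; simp
    rw [this, Fintype.card_piFinset_const]
    exact Nat.pow_le_pow_left (IsAddCyclic.card_nsmul_eq_zero_le hm0) _
  calc _ ≤ m ^ (k+1) * (A ^ (k+1) / m) := Nat.mul_le_mul_right _ h6
    _ = m ^ k * (m * (A ^ (k+1) / m)) := by ring
    _ ≤ m ^ k * A ^ (k+1) := Nat.mul_le_mul_left _ (Nat.mul_div_le _ _)
    _ = _ := mul_comm _ _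

open Finset in
lemma aux_sum (k M : ℕ) (hk : 1 ≤ k) :
    ∑ A ∈ Ioc 0 M, ∑ m ∈ A.divisors, m ^ k ≤ 2 * M ^ (k+1) := by
  have h1 : ∑ A ∈ Ioc 0 M, ∑ m ∈ A.divisors, m ^ k
      = ∑ g ∈ Ioc 0 M, ∑ m ∈ Ioc 0 (M / g), m ^ k := by
    have := ArithmeticFunction.sum_Ioc_mul_eq_sum_sum ArithmeticFunction.zeta
      (ArithmeticFunction.pow k) M
    rw [ArithmeticFunction.zeta_mul_pow_eq_sigma] at this
    simp only [ArithmeticFunction.sigma_apply] at this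
    rw [this]
    refine Finset.sum_congr rfl fun g hg => ?_
    have : g ≠ 0 := by simp at hg; omega
    simp only [ArithmeticFunction.zeta_apply, this, if_false, one_mul]
    refine Finset.sum_congr rfl fun m hm => ?_
    simp [ArithmeticFunction.pow_apply]; omega
  rw [h1]
  have h2 : ∀ g ∈ Ioc 0 M, ∑ m ∈ Ioc 0 (M / g), m ^ k ≤ (M / g) ^ (k+1) := by
    intro g hg
    refine (Finset.sum_le_card_nsmul _ _ ((M/g)^k) fun m hm => ?_).trans ?_
    · exact Nat.pow_le_pow_left (Finset.mem_Ioc.1 hm).2 _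
    · simp [pow_succ, mul_comm]
  refine (Finset.sum_le_sum h2).trans ?_
  have h3 : (((∑ g ∈ Ioc 0 M, (M / g) ^ (k+1) : ℕ)) : ℝ) ≤ ∑ g ∈ Ioc 0 M, (M:ℝ)^(k+1) * ((g:ℝ)^2)⁻¹ := by
    push_cast
    refine Finset.sum_le_sum fun g hg => ?_
    have hg1 : (1:ℝ) ≤ g := by
      have := (Finset.mem_Ioc.1 hg).1
      exact_mod_cast this
    calc (((M / g : ℕ)) : ℝ) ^ (k+1) ≤ ((M:ℝ)/g)^(k+1) := by
          gcongr; exact Nat.cast_div_le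
      _ = (M:ℝ)^(k+1) * ((g:ℝ)^(k+1))⁻¹ := by rw [div_pow]; rfl
      _ ≤ _ := by
        gcongr
        omega
  have h4 := sum_Ioo_inv_sq_le (α := ℝ) 0 (M+1)
  have h5 : Ioo 0 (M+1) = Ioc 0 M := by ext; simp
  rw [h5] at h4
  rw [← Finset.mul_sum] at h3
  have h6 : (M:ℝ)^(k+1) * ∑ g ∈ Ioc 0 M, ((g:ℝ)^2)⁻¹ ≤ (M:ℝ)^(k+1) * 2 := by
    gcongr; simpa using h4
  have := h3.trans h6
  have h7 : ((∑ g ∈ Ioc 0 M, (M / g) ^ (k+1) : ℕ) : ℝ) ≤ ((2 * M^(k+1) : ℕ) : ℝ) := by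
    push_cast at this ⊢; linarith
  exact_mod_cast h7

/-- pairs with maximum of the first attained at i with value A -/
noncomputable def auxF (k M : ℕ) (i : Fin (k+2)) (A : ℕ) : Finset ((Fin (k+2) → ℤ) × (Fin (k+2) → ℤ)) :=
  ((Fintype.piFinset fun _ => Finset.Icc (-(A:ℤ)) A) ×ˢ
    (Fintype.piFinset fun _ => Finset.Icc (-(M:ℤ)) M)).filter
    fun p => |p.1 i| = A ∧ ∑ j, p.1 j * p.2 j = 0

open Finset in
lemma aux_F (k M : ℕ) (i : Fin (k+2)) (A : ℕ) (hA : 0 < A) (hAM : A ≤ M) :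
    #(auxF k M i A) ≤ 2 * 12 ^ (k+1) * M ^ (k+1) * ∑ m ∈ A.divisors, m ^ k := by
  haveI : NeZero A := ⟨hA.ne'⟩
  have hA' : (0:ℤ) < A := by exact_mod_cast hA
  let T : Finset ((Fin (k+1) → ZMod A) × (Fin (k+1) → ZMod A)) :=
    {p | ∑ j, p.1 j * p.2 j = 0}
  let tgt := (({(A:ℤ), -(A:ℤ)} : Finset ℤ) ×ˢ T) ×ˢ
    ((Fintype.piFinset fun _ : Fin (k+1) => Icc (-1:ℤ) 1) ×ˢ
     (Fintype.piFinset fun _ : Fin (k+1) => Icc (-((M/A : ℕ):ℤ) - 1) ((M/A : ℕ):ℤ)))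
  let f : (Fin (k+2) → ℤ) × (Fin (k+2) → ℤ) →
      (ℤ × ((Fin (k+1) → ZMod A) × (Fin (k+1) → ZMod A))) × ((Fin (k+1) → ℤ) × (Fin (k+1) → ℤ)) :=
    fun p => ((p.1 i, (fun j => (p.1 (i.succAbove j) : ZMod A), fun j => (p.2 (i.succAbove j) : ZMod A))),
      (fun j => p.1 (i.succAbove j) / A, fun j => p.2 (i.succAbove j) / A))
  have h1 : #(auxF k M i A) ≤ #tgt := by
    apply Finset.card_le_card_of_injOn f
    · rintro ⟨a, b⟩ hp
      simp only [auxF, coe_filter, mem_product, Fintype.mem_piFinset, mem_Icc, Set.mem_setOf_eq] at hp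
      obtain ⟨⟨ha, hb⟩, hai, hs⟩ := hp
      simp only [tgt, f, T, mem_coe, mem_product, Fintype.mem_piFinset, mem_Icc, mem_insert,
        mem_singleton, mem_filter, mem_univ, true_and]
      refine ⟨⟨?_, ?_⟩, ?_, ?_⟩
      · rcases abs_choice (a i) with h | h <;> omega
      · rw [Fin.sum_univ_succAbove _ i] at hs
        have h0 : ((a i : ℤ) : ZMod A) = 0 := by
          rw [ZMod.intCast_zmod_eq_zero_iff_dvd]
          rw [← hai]; exact abs_dvd_self _
        have := congrArg (Int.cast : ℤ → ZMod A) hs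
        push_cast at this
        rw [h0] at this
        simpa using this
      · intro j
        have := ha (i.succAbove j)
        constructor
        · rw [Int.le_ediv_iff_mul_le hA']; linarith
        · exact Int.ediv_le_of_le_mul hA' (by linarith)
      · intro j
        have := hb (i.succAbove j)
        have hq : (M:ℤ) < (((M/A : ℕ):ℤ) + 1) * A := by
          have := Nat.lt_div_mul_add (a := M) hA
          rw [add_mul, one_mul]; exact_mod_cast this
        constructor
        · rw [Int.le_ediv_iff_mul_le hA']; linarith
        · exact Int.lt_add_one_iff.1 (Int.ediv_lt_of_lt_mul hA' (by linarith))
    · rintro ⟨a, b⟩ hp ⟨a', b'⟩ hp' heq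
      simp only [auxF, coe_filter, mem_product, Fintype.mem_piFinset, mem_Icc, Set.mem_setOf_eq] at hp hp'
      obtain ⟨⟨ha, hb⟩, hai, hs⟩ := hp
      obtain ⟨⟨ha', hb'⟩, hai', hs'⟩ := hp'
      simp only [f, Prod.mk.injEq] at heq
      obtain ⟨⟨e1, e2, e3⟩, e4, e5⟩ := heq
      have mk : ∀ x y : ℤ, (x : ZMod A) = y → x / A = y / A → x = y := by
        intro x y h h'
        rw [ZMod.intCast_eq_intCast_iff'] at h
        rw [← Int.emod_add_mul_ediv x A, ← Int.emod_add_mul_ediv y A, h, h']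
      have ea : ∀ j, a (i.succAbove j) = a' (i.succAbove j) := fun j =>
        mk _ _ (congrFun e2 j) (congrFun e4 j)
      have eb : ∀ j, b (i.succAbove j) = b' (i.succAbove j) := fun j =>
        mk _ _ (congrFun e3 j) (congrFun e5 j)
      rw [Fin.sum_univ_succAbove _ i] at hs hs'
      have hne : a i ≠ 0 := by
        intro h; rw [h] at hai; simp at hai; omega
      have ebi : b i = b' i := by
        simp only [ea, eb, e1] at hs
        rw [e1] at hne
        apply mul_left_cancel₀ hne
        linarith
      refine Prod.ext ?_ ?_
      · funext j
        rcases Fin.eq_self_or_eq_succAbove i j with rfl | ⟨l, rfl⟩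
        · exact e1
        · exact ea l
      · funext j
        rcases Fin.eq_self_or_eq_succAbove i j with rfl | ⟨l, rfl⟩
        · exact ebi
        · exact eb l
  have hq1 : 1 ≤ M / A := by rw [Nat.le_div_iff_mul_le hA]; omega
  have h2 : #tgt ≤ (2 * #T) * (3 ^ (k+1) * (4 * (M/A)) ^ (k+1)) := by
    simp only [tgt, card_product, Fintype.card_piFinset_const, Int.card_Icc]
    gcongr
    · exact Finset.card_le_two
    · norm_num
    · omega
  have hT : #T ≤ _ := aux_T k A
  calc _ ≤ _ := h1
    _ ≤ _ := h2
    _ ≤ (2 * (A ^ (k+1) * ∑ m ∈ A.divisors, m ^ k)) * (3 ^ (k+1) * (4 * (M/A)) ^ (k+1)) := by gcongr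
    _ = 2 * (3*4)^(k+1) * (A * (M/A))^(k+1) * ∑ m ∈ A.divisors, m ^ k := by
      simp only [mul_pow]; ring
    _ ≤ _ := by
      norm_num
      gcongr
      exact Nat.mul_div_le _ _

open Finset in
lemma aux_total (k M : ℕ) (hk : 1 ≤ k) :
    #(univ.biUnion fun i : Fin (k+2) => (Ioc 0 M).biUnion fun A => auxF k M i A)
      ≤ (k+2) * (4 * 12^(k+1)) * M ^ (2*(k+1)) := by
  have : ∀ i : Fin (k+2), #((Ioc 0 M).biUnion fun A => auxF k M i A) ≤ 4 * 12^(k+1) * M ^ (2*(k+1)) := by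
    intro i
    refine card_biUnion_le.trans ?_
    refine (sum_le_sum fun A hA => aux_F k M i A (mem_Ioc.1 hA).1 (mem_Ioc.1 hA).2).trans ?_
    rw [← mul_sum]
    refine (Nat.mul_le_mul_left _ (aux_sum k M hk)).trans (le_of_eq ?_)
    ring
  refine card_biUnion_le.trans ((sum_le_card_nsmul _ _ _ fun i _ => this i).trans (le_of_eq ?_))
  simp; ring

/-- **Count of exact resonances on the square torus.** For `d ≥ 3` there is `C_d > 0`
such that for all `N ≥ 2`, the number of pairs of nonzero integer vectors `a, b ∈ ℤ^d∖{0}`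
with `|a| ≤ N`, `|b| ≤ N` and `⟨a,b⟩ = 0` is at most `C_d · N^{2d−2}`. -/
theorem orthogonal_lattice_pair_count (d : ℕ) (hd : 3 ≤ d) :
    ∃ C : ℝ, 0 < C ∧ ∀ N : ℝ, 2 ≤ N →
      {p : (Fin d → ℤ) × (Fin d → ℤ) |
        p.1 ≠ 0 ∧ p.2 ≠ 0 ∧
        Real.sqrt (∑ j, ((p.1 j : ℝ)) ^ 2) ≤ N ∧
        Real.sqrt (∑ j, ((p.2 j : ℝ)) ^ 2) ≤ N ∧
        (∑ j, p.1 j * p.2 j) = 0}.Finite ∧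
      (Nat.card {p : (Fin d → ℤ) × (Fin d → ℤ) |
        p.1 ≠ 0 ∧ p.2 ≠ 0 ∧
        Real.sqrt (∑ j, ((p.1 j : ℝ)) ^ 2) ≤ N ∧
        Real.sqrt (∑ j, ((p.2 j : ℝ)) ^ 2) ≤ N ∧
        (∑ j, p.1 j * p.2 j) = 0} : ℝ) ≤ C * N ^ (2 * d - 2) := by
  obtain ⟨k, rfl⟩ : ∃ k, d = k + 2 := ⟨d - 2, by omega⟩
  have hk : 1 ≤ k := by omega
  refine ⟨(k+2) * (4 * 12^(k+1)), by positivity, fun N hN => ?_⟩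
  set S := {p : (Fin (k+2) → ℤ) × (Fin (k+2) → ℤ) |
        p.1 ≠ 0 ∧ p.2 ≠ 0 ∧
        Real.sqrt (∑ j, ((p.1 j : ℝ)) ^ 2) ≤ N ∧
        Real.sqrt (∑ j, ((p.2 j : ℝ)) ^ 2) ≤ N ∧
        (∑ j, p.1 j * p.2 j) = 0} with hS
  have hN0 : 0 ≤ N := by linarith
  set M := ⌊N⌋₊ with hM
  have hb : ∀ a : Fin (k+2) → ℤ, Real.sqrt (∑ j, ((a j : ℝ)) ^ 2) ≤ N → ∀ j, |a j| ≤ M := by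
    intro a ha j
    have h1 : |(a j : ℝ)| ≤ N := by
      refine le_trans ?_ ha
      apply Real.abs_le_sqrt
      exact Finset.single_le_sum (f := fun j => ((a j : ℝ))^2) (fun _ _ => sq_nonneg _) (Finset.mem_univ j)
    have h2 : (((a j).natAbs : ℕ) : ℝ) ≤ N := by
      rw [Nat.cast_natAbs]; exact_mod_cast h1
    have h3 := Nat.le_floor h2
    rw [Int.abs_eq_natAbs]
    exact_mod_cast h3
  have hsub : S ⊆ ((Finset.univ.biUnion fun i : Fin (k+2) => (Finset.Ioc 0 M).biUnion fun A => auxF k M i A : Finset _) : Set _) := by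
    rintro ⟨a, b⟩ ⟨ha0, -, ha, hbb, hs⟩
    obtain ⟨i, -, hi⟩ := Finset.exists_max_image (Finset.univ : Finset (Fin (k+2))) (fun j => |a j|) ⟨0, Finset.mem_univ _⟩
    have hpos : a i ≠ 0 := by
      intro h
      apply ha0
      funext j
      have := hi j (Finset.mem_univ j)
      rw [h] at this
      simpa using this
    simp only [Finset.coe_biUnion, Set.mem_iUnion, Finset.mem_coe, Finset.mem_univ, Finset.mem_Ioc]
    have hbi := hb a ha i
    rw [Int.abs_eq_natAbs] at hbi
    refine ⟨i, trivial, (a i).natAbs, ⟨by omega, by omega⟩, ?_⟩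
    simp only [auxF, Finset.mem_filter, Finset.mem_product, Fintype.mem_piFinset, Finset.mem_Icc]
    refine ⟨⟨fun j => ?_, fun j => ?_⟩, Int.abs_eq_natAbs _, hs⟩
    · have := hi j (Finset.mem_univ j)
      rw [Int.abs_eq_natAbs (a i)] at this
      exact abs_le.1 this
    · exact abs_le.1 (hb b hbb j)
  refine ⟨(Finset.finite_toSet _).subset hsub, ?_⟩
  have h1 : Nat.card S ≤ (k+2) * (4 * 12^(k+1)) * M ^ (2*(k+1)) := by
    refine le_trans ?_ (aux_total k M hk)
    have := Set.ncard_le_ncard hsub (Finset.finite_toSet _)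
    rwa [Set.ncard_coe_finset] at this
  have h2 : ((Nat.card S : ℕ) : ℝ) ≤ (k+2) * (4 * 12^(k+1)) * (M:ℝ) ^ (2*(k+1)) := by exact_mod_cast h1
  refine h2.trans ?_
  have h3 : 2 * (k+2) - 2 = 2*(k+1) := by omega
  rw [h3]
  gcongr
  exact Nat.floor_le hN0
end
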